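/- Let U be a seed transformation with blocks as above, and let 𝔩 ⊆ F_2^{2m} be the span of the rows of Λ_M together with the rows of Σ_M. Then a vector M′ ∈ F_2^{2m} is the endpoint of an edge of physical weight 0 and logical weight 0 — i.e., there exist M ∈ F_2^{2m} and S ∈ F_2^{n−k} with (M : 0_{2k} : S) U_eff = (0_{2n} : M′) — if and only if M′ ∈ 𝔩^⊥ (the orthogonal complement of 𝔩 under the Λ_m-symplectic product). -/

import Mathlib

open Matrix

/-- The 2N×2N binary matrix Λ_N, block diagonal with N copies of [[0,1],[1,0]]. -/
def lambdaMat (N : ℕ) : Matrix (Fin (2 * N)) (Fin (2 * N)) (ZMod 2) :=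
  Matrix.of fun i j => if i.val / 2 = j.val / 2 ∧ i ≠ j then 1 else 0

/-- The symplectic product P ⋆ Q = P Λ_N Qᵀ of row vectors P, Q ∈ F_2^{2N}. -/
def sstar {N : ℕ} (P Q : Fin (2 * N) → ZMod 2) : ZMod 2 :=
  Matrix.vecMul P (lambdaMat N) ⬝ᵥ Q

/-- A 2N×2N binary matrix is symplectic if U Λ_N Uᵀ = Λ_N.  A seed transformation of a
quantum convolutional encoder with parameters (n,k,m) is a symplectic 2(n+m)×2(n+m) matrix. -/
def IsSymplectic {N : ℕ} (U : Matrix (Fin (2 * N)) (Fin (2 * N)) (ZMod 2)) : Prop :=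
  U * lambdaMat N * Uᵀ = lambdaMat N


/-- The block μ_P of a seed transformation: rows 1..2m, first 2n columns. -/
def muP (n m : ℕ) (U : Matrix (Fin (2 * (n + m))) (Fin (2 * (n + m))) (ZMod 2)) :
    Matrix (Fin (2 * m)) (Fin (2 * n)) (ZMod 2) :=
  Matrix.of fun i j =>
    U ⟨i.val, by have := i.isLt; omega⟩ ⟨j.val, by have := j.isLt; omega⟩

/-- The block μ_M of a seed transformation: rows 1..2m, last 2m columns. -/
def muM (n m : ℕ) (U : Matrix (Fin (2 * (n + m))) (Fin (2 * (n + m))) (ZMod 2)) :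
    Matrix (Fin (2 * m)) (Fin (2 * m)) (ZMod 2) :=
  Matrix.of fun i j =>
    U ⟨i.val, by have := i.isLt; omega⟩ ⟨2 * n + j.val, by have := j.isLt; omega⟩

/-- The block Λ_P of a seed transformation: rows 2m+1..2m+2k, first 2n columns. -/
def lamP (n k m : ℕ) (hk : k ≤ n)
    (U : Matrix (Fin (2 * (n + m))) (Fin (2 * (n + m))) (ZMod 2)) :
    Matrix (Fin (2 * k)) (Fin (2 * n)) (ZMod 2) :=
  Matrix.of fun i j =>
    U ⟨2 * m + i.val, by have := i.isLt; omega⟩ ⟨j.val, by have := j.isLt; omega⟩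

/-- The block Λ_M of a seed transformation: rows 2m+1..2m+2k, last 2m columns. -/
def lamM (n k m : ℕ) (hk : k ≤ n)
    (U : Matrix (Fin (2 * (n + m))) (Fin (2 * (n + m))) (ZMod 2)) :
    Matrix (Fin (2 * k)) (Fin (2 * m)) (ZMod 2) :=
  Matrix.of fun i j =>
    U ⟨2 * m + i.val, by have := i.isLt; omega⟩ ⟨2 * n + j.val, by have := j.isLt; omega⟩

/-- The block Σ_P of a seed transformation: rows of index 2m+2k+2i (1-indexed,
i = 1,…,n−k), first 2n columns. -/
def sigP (n k m : ℕ)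
    (U : Matrix (Fin (2 * (n + m))) (Fin (2 * (n + m))) (ZMod 2)) :
    Matrix (Fin (n - k)) (Fin (2 * n)) (ZMod 2) :=
  Matrix.of fun i j =>
    U ⟨2 * m + 2 * k + 2 * i.val + 1, by have := i.isLt; omega⟩
      ⟨j.val, by have := j.isLt; omega⟩

/-- The block Σ_M of a seed transformation: rows of index 2m+2k+2i (1-indexed,
i = 1,…,n−k), last 2m columns. -/
def sigM (n k m : ℕ)
    (U : Matrix (Fin (2 * (n + m))) (Fin (2 * (n + m))) (ZMod 2)) :
    Matrix (Fin (n - k)) (Fin (2 * m)) (ZMod 2) :=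
  Matrix.of fun i j =>
    U ⟨2 * m + 2 * k + 2 * i.val + 1, by have := i.isLt; omega⟩
      ⟨2 * n + j.val, by have := j.isLt; omega⟩


/-- (M:L:S) U_eff = (0_{2n} : M′): an edge of physical weight 0 (with syndrome input S)
from M to M′ with logical label L in the state diagram of the seed transformation U. -/
def ZeroPhysEdge (n k m : ℕ) (hk : k ≤ n)
    (U : Matrix (Fin (2 * (n + m))) (Fin (2 * (n + m))) (ZMod 2))
    (M : Fin (2 * m) → ZMod 2) (L : Fin (2 * k) → ZMod 2)
    (S : Fin (n - k) → ZMod 2) (M' : Fin (2 * m) → ZMod 2) : Prop :=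
  Matrix.vecMul M (muP n m U) + Matrix.vecMul L (lamP n k m hk U)
      + Matrix.vecMul S (sigP n k m U) = 0 ∧
  Matrix.vecMul M (muM n m U) + Matrix.vecMul L (lamM n k m hk U)
      + Matrix.vecMul S (sigM n k m U) = M'

/-- The orthogonal complement of a subspace W ⊆ F_2^{2m} under the symplectic product. -/
def sperp (m : ℕ) (W : Submodule (ZMod 2) (Fin (2 * m) → ZMod 2)) :
    Set (Fin (2 * m) → ZMod 2) :=
  {M | ∀ T ∈ W, sstar M T = 0}

/-- The index paired with `i` by `lambdaMat N`. -/
def lambdaPartner {N : ℕ} (i : Fin (2 * N)) : Fin (2 * N) :=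
  ⟨if i.val % 2 = 0 then i.val + 1 else i.val - 1, by have := i.isLt; split <;> omega⟩

theorem lambdaMat_apply {N : ℕ} (i j : Fin (2 * N)) :
    lambdaMat N i j = if lambdaPartner i = j then 1 else 0 := by
  simp only [lambdaMat, lambdaPartner, Matrix.of_apply, Fin.ext_iff, ne_eq]
  congr 1
  apply propext
  split <;> omega

theorem lambdaMat_mul_self (N : ℕ) : lambdaMat N * lambdaMat N = 1 := by
  ext i j
  have h : lambdaPartner (lambdaPartner i) = i := by
    simp only [lambdaPartner, Fin.ext_iff]
    split_ifs <;> omega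
  rw [Matrix.mul_apply, Finset.sum_eq_single (lambdaPartner i)]
  · simp [lambdaMat_apply, h, Matrix.one_apply]
  · intro x _ hx
    simp [lambdaMat_apply, hx.symm]
  · simp

theorem IsSymplectic.inverse_mul {N : ℕ} {U : Matrix (Fin (2 * N)) (Fin (2 * N)) (ZMod 2)}
    (hU : IsSymplectic U) : lambdaMat N * Uᵀ * lambdaMat N * U = 1 := by
  rw [mul_eq_one_comm, ← Matrix.mul_assoc, ← Matrix.mul_assoc,
    show U * lambdaMat N * Uᵀ = lambdaMat N from hU, lambdaMat_mul_self]

theorem vecMul_lambdaMat_mul_transpose {N : ℕ} (V : Fin (2 * N) → ZMod 2)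
    (U : Matrix (Fin (2 * N)) (Fin (2 * N)) (ZMod 2)) (i : Fin (2 * N)) :
    Matrix.vecMul V (lambdaMat N * Uᵀ) i = sstar V (U i) := by
  rw [← Matrix.vecMul_vecMul]
  rfl

theorem mem_sperp_span_iff {m : ℕ} {M : Fin (2 * m) → ZMod 2}
    {s : Set (Fin (2 * m) → ZMod 2)} :
    M ∈ sperp m (Submodule.span (ZMod 2) s) ↔ ∀ T ∈ s, sstar M T = 0 := by
  refine ⟨fun h T hT => h T (Submodule.subset_span hT), fun h T hT => ?_⟩
  induction hT using Submodule.span_induction with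
  | mem T hT => exact h T hT
  | zero => simp [sstar]
  | add x y _ _ hx hy =>
    simp only [sstar, dotProduct_add] at *
    rw [hx, hy, add_zero]
  | smul a x _ hx =>
    simp only [sstar, dotProduct_smul] at *
    rw [hx, smul_zero]

section Columns

variable (n m : ℕ)

/-- The columns of a seed transformation: `2n` physical ones followed by `2m` memory ones. -/
def columnIndex : Fin (2 * n) ⊕ Fin (2 * m) → Fin (2 * (n + m)) :=
  Sum.elim (fun j => ⟨j.val, by have := j.isLt; omega⟩)
    (fun j => ⟨2 * n + j.val, by have := j.isLt; omega⟩)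

theorem columnIndex_bijective : Function.Bijective (columnIndex n m) := by
  rw [Fintype.bijective_iff_injective_and_card]
  constructor
  · rintro (i | i) (j | j) h <;>
      simp only [columnIndex, Sum.elim_inl, Sum.elim_inr, Fin.mk.injEq] at h <;>
      have := i.isLt <;> have := j.isLt <;>
      first
        | omega
        | (congr 1; ext; omega)
  · simp only [Fintype.card_sum, Fintype.card_fin]
    omega

/-- The equivalence underlying `columnIndex`. -/
noncomputable def columnEquiv : Fin (2 * n) ⊕ Fin (2 * m) ≃ Fin (2 * (n + m)) :=
  Equiv.ofBijective _ (columnIndex_bijective n m)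

/-- The vector `(0 : M')`. -/
noncomputable def memoryVector (M' : Fin (2 * m) → ZMod 2) : Fin (2 * (n + m)) → ZMod 2 :=
  Sum.elim (0 : Fin (2 * n) → ZMod 2) M' ∘ (columnEquiv n m).symm

theorem memoryVector_columnIndex (M' : Fin (2 * m) → ZMod 2) (c : Fin (2 * n) ⊕ Fin (2 * m)) :
    memoryVector n m M' (columnIndex n m c) = Sum.elim (0 : Fin (2 * n) → ZMod 2) M' c :=
  congrArg (Sum.elim (0 : Fin (2 * n) → ZMod 2) M') ((columnEquiv n m).symm_apply_apply c)

theorem sstar_memoryVector (M' : Fin (2 * m) → ZMod 2) (Q : Fin (2 * (n + m)) → ZMod 2) :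
    sstar (memoryVector n m M') Q = sstar M' fun j => Q (columnIndex n m (Sum.inr j)) := by
  have hsum (f : Fin (2 * (n + m)) → ZMod 2) := ((columnIndex_bijective n m).sum_comp f).symm
  have hP (i : Fin (2 * m)) (j : Fin (2 * n)) :
      lambdaMat (n + m) (columnIndex n m (Sum.inr i)) (columnIndex n m (Sum.inl j)) = 0 := by
    have := j.isLt
    simp only [lambdaMat, columnIndex, Sum.elim_inl, Sum.elim_inr, Matrix.of_apply]
    exact if_neg (by omega)
  have hM (i j : Fin (2 * m)) :
      lambdaMat (n + m) (columnIndex n m (Sum.inr i)) (columnIndex n m (Sum.inr j))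
        = lambdaMat m i j := by
    simp only [lambdaMat, columnIndex, Sum.elim_inr, Matrix.of_apply, ne_eq, Fin.ext_iff]
    congr 1
    apply propext
    omega
  simp [sstar, dotProduct, Matrix.vecMul, hsum, memoryVector_columnIndex, hP, hM]

end Columns

section Rows

variable (n k m : ℕ)

/-- The rows of a seed transformation: memory rows, logical rows, the syndrome rows that
enter `U_eff`, and the remaining syndrome rows. -/
def rowIndex (hk : k ≤ n) :
    (Fin (2 * m) ⊕ Fin (n - k)) ⊕ (Fin (2 * k) ⊕ Fin (n - k)) → Fin (2 * (n + m)) :=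
  Sum.elim
    (Sum.elim (fun i => ⟨i.val, by have := i.isLt; omega⟩)
      (fun i => ⟨2 * m + 2 * k + 2 * i.val + 1, by have := i.isLt; omega⟩))
    (Sum.elim (fun i => ⟨2 * m + i.val, by have := i.isLt; omega⟩)
      (fun i => ⟨2 * m + 2 * k + 2 * i.val, by have := i.isLt; omega⟩))

theorem rowIndex_bijective (hk : k ≤ n) : Function.Bijective (rowIndex n k m hk) := by
  rw [Fintype.bijective_iff_injective_and_card]
  constructor
  · rintro ((i | i) | (i | i)) ((j | j) | (j | j)) h <;>
      simp only [rowIndex, Sum.elim_inl, Sum.elim_inr, Fin.mk.injEq] at h <;>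
      have := i.isLt <;> have := j.isLt <;>
      first
        | omega
        | (congr 2; ext; omega)
  · simp only [Fintype.card_sum, Fintype.card_fin]
    omega

/-- The equivalence underlying `rowIndex`. -/
noncomputable def rowEquiv (hk : k ≤ n) :
    (Fin (2 * m) ⊕ Fin (n - k)) ⊕ (Fin (2 * k) ⊕ Fin (n - k)) ≃ Fin (2 * (n + m)) :=
  Equiv.ofBijective _ (rowIndex_bijective n k m hk)

/-- The input vector with memory part `M`, zero logical part and effective syndrome part `S`. -/
noncomputable def inputVector (hk : k ≤ n) (M : Fin (2 * m) → ZMod 2) (S : Fin (n - k) → ZMod 2) :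
    Fin (2 * (n + m)) → ZMod 2 :=
  Sum.elim (Sum.elim M S) 0 ∘ (rowEquiv n k m hk).symm

theorem inputVector_rowIndex (hk : k ≤ n) (M : Fin (2 * m) → ZMod 2) (S : Fin (n - k) → ZMod 2)
    (r : (Fin (2 * m) ⊕ Fin (n - k)) ⊕ (Fin (2 * k) ⊕ Fin (n - k))) :
    inputVector n k m hk M S (rowIndex n k m hk r) = Sum.elim (Sum.elim M S) 0 r :=
  congrArg (Sum.elim (Sum.elim M S) 0) ((rowEquiv n k m hk).symm_apply_apply r)

theorem zeroPhysEdge_iff_vecMul (hk : k ≤ n)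
    (U : Matrix (Fin (2 * (n + m))) (Fin (2 * (n + m))) (ZMod 2))
    (M : Fin (2 * m) → ZMod 2) (S : Fin (n - k) → ZMod 2) (M' : Fin (2 * m) → ZMod 2) :
    ZeroPhysEdge n k m hk U M 0 S M' ↔
      Matrix.vecMul (inputVector n k m hk M S) U = memoryVector n m M' := by
  have hsum (f : Fin (2 * (n + m)) → ZMod 2) := ((rowIndex_bijective n k m hk).sum_comp f).symm
  rw [funext_iff (f := Matrix.vecMul _ U), ← (columnIndex_bijective n m).surjective.forall.symm,
    Sum.forall, ZeroPhysEdge, funext_iff, funext_iff]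
  simp only [memoryVector_columnIndex, Matrix.vecMul, dotProduct, hsum, Fintype.sum_sum_type,
    inputVector_rowIndex, Sum.elim_inl, Sum.elim_inr, Pi.add_apply, Pi.zero_apply, zero_mul,
    Finset.sum_const_zero, add_zero]
  rfl

/-- No row of `U_eff` other than a logical one is paired with a logical row or with a syndrome row
of `U_eff`. -/
theorem lambdaMat_rowIndex_inl_eq_zero (hk : k ≤ n) (a : Fin (2 * m) ⊕ Fin (n - k)) :
    (∀ i, lambdaMat (n + m) (rowIndex n k m hk (Sum.inl a))
      (rowIndex n k m hk (Sum.inr (Sum.inl i))) = 0) ∧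
    ∀ l, lambdaMat (n + m) (rowIndex n k m hk (Sum.inl a))
      (rowIndex n k m hk (Sum.inl (Sum.inr l))) = 0 := by
  constructor <;> intro i <;> have := i.isLt <;> rcases a with a | a <;> have := a.isLt <;>
    simp only [lambdaMat, rowIndex, Sum.elim_inl, Sum.elim_inr, Matrix.of_apply, ne_eq,
      Fin.mk.injEq] <;>
    exact if_neg (by omega)

/-- No memory row and no syndrome row outside `U_eff` is paired with a logical row or with a
syndrome row outside `U_eff`. -/
theorem lambdaMat_rowIndex_inr_eq_zero (hk : k ≤ n) (b : Fin (2 * k) ⊕ Fin (n - k)) :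
    (∀ i, lambdaMat (n + m) (rowIndex n k m hk (Sum.inl (Sum.inl i)))
      (rowIndex n k m hk (Sum.inr b)) = 0) ∧
    ∀ l, lambdaMat (n + m) (rowIndex n k m hk (Sum.inr (Sum.inr l)))
      (rowIndex n k m hk (Sum.inr b)) = 0 := by
  constructor <;> intro i <;> have := i.isLt <;> rcases b with b | b <;> have := b.isLt <;>
    simp only [lambdaMat, rowIndex, Sum.elim_inl, Sum.elim_inr, Matrix.of_apply, ne_eq,
      Fin.mk.injEq] <;>
    exact if_neg (by omega)

end Rows

/-- let 𝔩 be the span of the rows of Λ_M together with the rows of Σ_M.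
Then M′ is the endpoint of an edge of physical weight 0 and logical weight 0 — i.e.
(M : 0_{2k} : S) U_eff = (0_{2n} : M′) for some M and S — iff M′ ∈ 𝔩^⊥. -/
theorem stmt_17 (n k m : ℕ) (hn : 1 ≤ n) (hk : k ≤ n) (hm : 1 ≤ m)
    (U : Matrix (Fin (2 * (n + m))) (Fin (2 * (n + m))) (ZMod 2))
    (hU : IsSymplectic U)
    (M' : Fin (2 * m) → ZMod 2) :
    (∃ (M : Fin (2 * m) → ZMod 2) (S : Fin (n - k) → ZMod 2),
        ZeroPhysEdge n k m hk U M 0 S M')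
      ↔ M' ∈ sperp m (Submodule.span (ZMod 2)
          ((Set.range fun i => lamM n k m hk U i) ∪ (Set.range fun l => sigM n k m U l))) := by
  have hsum (f : Fin (2 * (n + m)) → ZMod 2) := ((rowIndex_bijective n k m hk).sum_comp f).symm
  have hperp : M' ∈ sperp m (Submodule.span (ZMod 2)
        ((Set.range fun i => lamM n k m hk U i) ∪ (Set.range fun l => sigM n k m U l))) ↔
      (∀ i, sstar (memoryVector n m M') (U (rowIndex n k m hk (Sum.inr (Sum.inl i)))) = 0) ∧
      ∀ l, sstar (memoryVector n m M') (U (rowIndex n k m hk (Sum.inl (Sum.inr l)))) = 0 := by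
    simp only [mem_sperp_span_iff, Set.mem_union, or_imp, forall_and, Set.forall_mem_range,
      sstar_memoryVector]
    rfl
  simp only [zeroPhysEdge_iff_vecMul, hperp]
  constructor
  · rintro ⟨M, S, h⟩
    have key (j) : sstar (memoryVector n m M') (U j) =
        Matrix.vecMul (inputVector n k m hk M S) (lambdaMat (n + m)) j := by
      rw [← vecMul_lambdaMat_mul_transpose, ← h, Matrix.vecMul_vecMul, ← Matrix.mul_assoc,
        show U * lambdaMat (n + m) * Uᵀ = lambdaMat (n + m) from hU]
    constructor <;> intro i <;>
      simp [key, Matrix.vecMul, dotProduct, hsum, inputVector_rowIndex,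
        lambdaMat_rowIndex_inl_eq_zero]
  · rintro ⟨hL, hS⟩
    obtain ⟨y, hy⟩ : ∃ y, Matrix.vecMul (memoryVector n m M') (lambdaMat (n + m) * Uᵀ) = y :=
      ⟨_, rfl⟩
    obtain ⟨x, hx⟩ : ∃ x, Matrix.vecMul y (lambdaMat (n + m)) = x := ⟨_, rfl⟩
    simp only [← vecMul_lambdaMat_mul_transpose, hy] at hL hS
    have hxU : Matrix.vecMul x U = memoryVector n m M' := by
      rw [← hx, ← hy, Matrix.vecMul_vecMul, Matrix.vecMul_vecMul, ← Matrix.mul_assoc,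
        hU.inverse_mul, Matrix.vecMul_one]
    have hx0 (b) : x (rowIndex n k m hk (Sum.inr b)) = 0 := by
      simp [← hx, Matrix.vecMul, dotProduct, hsum, lambdaMat_rowIndex_inr_eq_zero, hL, hS]
    refine ⟨fun i => x (rowIndex n k m hk (Sum.inl (Sum.inl i))),
      fun l => x (rowIndex n k m hk (Sum.inl (Sum.inr l))), ?_⟩
    convert hxU using 2
    funext j
    obtain ⟨r, rfl⟩ := (rowIndex_bijective n k m hk).surjective j
    rw [inputVector_rowIndex]
    rcases r with (i | l) | b
    · rfl
    · rfl
    · exact (hx0 b).symm
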